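/- arXiv:1908.03969 — 3 statements merged into one kernel-verified Lean document; each statement's English description precedes it below -/
import Mathlib

section
/- Let K and K′ be totally real V₄-quartic subfields of ℂ. Let (Δ₁, Δ₂, Δ₃) and (Δ′₁, Δ′₂, Δ′₃) be the discriminants of the three quadratic subfields of K and of K′ respectively, each triple labeled in increasing order. If there exists a real λ > 0 with Δ′ᵢ = λ·Δᵢ for i = 1, 2, 3, then K = K′. -/
noncomputable section

/-- The (absolute) discriminant of a subfield of `ℂ`, defined to be `0` when the
field is not finite-dimensional over `ℚ`. -/
def quartDisc (K : IntermediateField ℚ ℂ) : ℤ := by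
  classical
  exact if h : FiniteDimensional ℚ K then
    haveI : CharZero K := charZero_of_injective_algebraMap (algebraMap ℚ K).injective
    haveI : NumberField K := ⟨⟩
    NumberField.discr K
  else 0

/-- A `V₄`-quartic field: a subfield of `ℂ` of degree 4 over `ℚ`, Galois over `ℚ`, with
Galois group isomorphic to the Klein four-group. -/
def IsV4Quartic (K : IntermediateField ℚ ℂ) : Prop :=
  Module.finrank ℚ K = 4 ∧ IsGalois ℚ K ∧
    Nonempty ((K ≃ₐ[ℚ] K) ≃* Multiplicative (ZMod 2 × ZMod 2))

/-- `F` is a quadratic subfield of `K`. -/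
def IsQuadSubfield (K F : IntermediateField ℚ ℂ) : Prop :=
  F ≤ K ∧ Module.finrank ℚ F = 2

/-- `K` is totally real: every embedding of `K` into `ℂ` has image contained in `ℝ`. -/
def IsTotallyRealSubfield (K : IntermediateField ℚ ℂ) : Prop :=
  ∀ (σ : K →+* ℂ) (x : K), (σ x).im = 0

theorem quad_gen (F : Type*) [Field F] [NumberField F] (h2 : Module.finrank ℚ F = 2) :
    ∃ x : F, x ^ 2 = (NumberField.discr F : F) ∧ (∀ a : ℚ, x ≠ (a : F)) ∧
      ∀ y : F, ∃ a b : ℚ, y = a + b * x := by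
  classical
  obtain ⟨y, hy⟩ : ∃ y : F, ∀ a : ℚ, y ≠ (a : F) := by
    by_contra hcon
    push Not at hcon
    have : Module.finrank ℚ F ≤ 1 := finrank_le_one (1 : F) (fun w => by
      obtain ⟨a, ha⟩ := hcon w
      exact ⟨a, by rw [ha, Rat.smul_def, mul_one]⟩)
    omega
  have span : ∀ z : F, (∀ a : ℚ, z ≠ (a : F)) → LinearIndependent ℚ ![(1 : F), z] := by
    intro z hz
    rw [LinearIndependent.pair_iff]
    intro s t hst
    have ht : t = 0 := by
      by_contra ht
      apply hz (-s / t)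
      have ht' : (t : F) ≠ 0 := by exact_mod_cast ht
      push_cast
      rw [eq_div_iff ht']
      simp only [Rat.smul_def] at hst
      linear_combination hst
    subst ht
    refine ⟨?_, rfl⟩
    simpa using hst
  have rep : ∀ z : F, (∀ a : ℚ, z ≠ (a : F)) → ∀ w : F, ∃ a b : ℚ, w = a + b * z := by
    intro z hz w
    let B := basisOfLinearIndependentOfCardEqFinrank (span z hz) (by simp [h2])
    refine ⟨B.repr w 0, B.repr w 1, ?_⟩
    have := B.sum_repr w
    simp [B, Rat.smul_def] at this
    simpa [B] using this.symm
  obtain ⟨p, q, hpq⟩ := rep y hy (y ^ 2)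
  let z : F := y - (q / 2 : ℚ)
  have hz : ∀ a : ℚ, z ≠ (a : F) := by
    intro a ha
    apply hy (a + (q / 2 : ℚ))
    push_cast
    rw [← ha]
    simp [z]
  let D : ℚ := p + q ^ 2 / 4
  have hzz : z * z = algebraMap ℚ F D := by
    simp only [z, D, eq_ratCast]
    push_cast
    linear_combination hpq
  let B := basisOfLinearIndependentOfCardEqFinrank (span z hz) (by simp [h2])
  have hB0 : B 0 = 1 := by simp [B]
  have hB1 : B 1 = z := by simp [B]
  have tr0 : Algebra.trace ℚ F z = 0 := by
    rw [Algebra.trace_eq_matrix_trace B, Matrix.trace_fin_two]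
    rw [Algebra.leftMulMatrix_eq_repr_mul, Algebra.leftMulMatrix_eq_repr_mul, hB0, hB1, hzz, mul_one]
    rw [Algebra.algebraMap_eq_smul_one, ← hB0, ← hB1]
    simp
  have hdB : Algebra.discr ℚ B = 4 * D := by
    rw [Algebra.discr_def, Matrix.det_fin_two]
    simp only [Algebra.traceMatrix_apply, Algebra.traceForm_apply, hB0, hB1, hzz, mul_one, one_mul, tr0,
      Algebra.trace_algebraMap, h2]
    rw [← map_one (algebraMap ℚ F), Algebra.trace_algebraMap, h2]
    norm_num
    ring
  let e : Module.Free.ChooseBasisIndex ℤ (NumberField.RingOfIntegers F) ≃ Fin 2 :=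
    Fintype.equivOfCardEq (by
      rw [← Module.finrank_eq_card_basis (NumberField.integralBasis F), h2]; simp)
  let I := (NumberField.integralBasis F).reindex e
  have hdI : Algebra.discr ℚ I = NumberField.discr F := by
    rw [NumberField.coe_discr]
    simp only [I, Module.Basis.coe_reindex]
    rw [Algebra.discr_reindex]
  let P := B.toMatrix I
  have hP : Algebra.discr ℚ I = P.det ^ 2 * Algebra.discr ℚ B := by
    rw [← Algebra.discr_of_matrix_vecMul, Module.Basis.toMatrix_map_vecMul]
  have hne : (NumberField.discr F : ℚ) ≠ 0 := by exact_mod_cast NumberField.discr_ne_zero F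
  let r : ℚ := 2 * P.det
  have hr : (NumberField.discr F : ℚ) = r ^ 2 * D := by
    rw [← hdI, hP, hdB]; simp only [r]; ring
  have hr0 : r ≠ 0 := by
    intro h; rw [h] at hr; apply hne; rw [hr]; ring
  have hx : ∀ a : ℚ, (r : F) * z ≠ (a : F) := by
    intro a ha
    apply hz (a / r)
    have : (r : F) ≠ 0 := by exact_mod_cast hr0
    push_cast
    rw [eq_div_iff this, ← ha]; ring
  refine ⟨r * z, ?_, hx, rep _ hx⟩
  have : (NumberField.discr F : F) = ((NumberField.discr F : ℚ) : F) := by push_cast; rfl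
  rw [this, hr, mul_pow, pow_two z, hzz]
  push_cast
  simp

theorem quad_gen_sub (F : IntermediateField ℚ ℂ) (h2 : Module.finrank ℚ F = 2) :
    ∃ x : ℂ, x ∈ F ∧ x ^ 2 = ((quartDisc F : ℚ) : ℂ) ∧ (∀ a : ℚ, x ≠ (a : ℂ)) ∧
      ∀ y ∈ F, ∃ a b : ℚ, y = a + b * x := by
  have hfd : FiniteDimensional ℚ F := Module.finite_of_finrank_pos (by omega)
  haveI : CharZero F := charZero_of_injective_algebraMap (algebraMap ℚ F).injective
  haveI : NumberField F := ⟨⟩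
  obtain ⟨x, hx, hxr, hxs⟩ := quad_gen F h2
  have hq : quartDisc F = NumberField.discr F := by
    unfold quartDisc
    rw [dif_pos hfd]
  refine ⟨x, x.2, ?_, ?_, ?_⟩
  · rw [hq]
    have := congrArg (algebraMap F ℂ) hx
    simpa using this
  · intro a ha
    apply hxr a
    apply Subtype.ext
    simpa using ha
  · intro y hy
    obtain ⟨a, b, hab⟩ := hxs ⟨y, hy⟩
    refine ⟨a, b, ?_⟩
    have := congrArg (algebraMap F ℂ) hab
    simpa using this

theorem rat_mem (F : IntermediateField ℚ ℂ) (a : ℚ) : (a : ℂ) ∈ F := by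
  simpa using F.algebraMap_mem a

theorem quad_ne (F G : IntermediateField ℚ ℂ) (hF : Module.finrank ℚ F = 2)
    (hG : Module.finrank ℚ G = 2) (hFG : F ≠ G) (x y : ℂ) (hx : x ∈ F)
    (hy : ∀ w ∈ G, ∃ a b : ℚ, w = a + b * y) (a b : ℚ) : y ≠ a + b * x := by
  intro h
  haveI : FiniteDimensional ℚ F := Module.finite_of_finrank_pos (by omega)
  apply hFG
  symm
  apply IntermediateField.eq_of_le_of_finrank_eq
  · intro w hw
    obtain ⟨c, d, rfl⟩ := hy w hw
    rw [h]
    exact F.add_mem (rat_mem _ _) (F.mul_mem (rat_mem _ _)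
      (F.add_mem (rat_mem _ _) (F.mul_mem (rat_mem _ _) hx)))
  · rw [hF, hG]

/-- Independence of `1, x, y, xy`. -/
theorem indep4 (x y : ℂ) (A : ℚ) (hx2 : x ^ 2 = A) (hx : ∀ a : ℚ, x ≠ a)
    (hy : ∀ a b : ℚ, y ≠ a + b * x) (a b c d : ℚ)
    (h : (a : ℂ) + b * x + c * y + d * (x * y) = 0) : a = 0 ∧ b = 0 ∧ c = 0 ∧ d = 0 := by
  have key : ∀ s t : ℚ, (s : ℂ) + t * x = 0 → s = 0 ∧ t = 0 := by
    intro s t hst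
    have ht : t = 0 := by
      by_contra ht
      apply hx (-s / t)
      have ht' : (t : ℂ) ≠ 0 := by exact_mod_cast ht
      push_cast
      rw [eq_div_iff ht']
      linear_combination hst
    subst ht
    refine ⟨?_, rfl⟩
    simpa using hst
  by_cases hcd : (c : ℂ) + d * x = 0
  · obtain ⟨rfl, rfl⟩ := key _ _ hcd
    obtain ⟨rfl, rfl⟩ := key a b (by simpa using h)
    simp
  · exfalso
    have hN : (c : ℂ) ^ 2 - d ^ 2 * A ≠ 0 := by
      intro h0
      rw [← hx2] at h0
      have h1 : ((c : ℂ) + d * x) * (c + (-d : ℚ) * x) = 0 := by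
        push_cast; linear_combination h0
      rcases mul_eq_zero.mp h1 with h1 | h1
      · exact hcd h1
      · obtain ⟨h3, h4⟩ := key _ _ h1
        apply hcd
        have : d = 0 := by linarith
        simp [h3, this]
    -- y = -(a+bx)(c-dx)/N
    apply hy (-(a * c - b * d * A) / (c ^ 2 - d ^ 2 * A)) (-(b * c - a * d) / (c ^ 2 - d ^ 2 * A))
    push_cast
    field_simp
    rw [← hx2]
    linear_combination (c - d * x) * h

theorem span4 (K : IntermediateField ℚ ℂ) (hK : Module.finrank ℚ K = 4) (x y : ℂ)
    (hxK : x ∈ K) (hyK : y ∈ K) (A : ℚ) (hx2 : x ^ 2 = A) (hx : ∀ a : ℚ, x ≠ a)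
    (hy : ∀ a b : ℚ, y ≠ a + b * x) (w : ℂ) (hw : w ∈ K) :
    ∃ a b c d : ℚ, w = a + b * x + c * y + d * (x * y) := by
  let X : K := ⟨x, hxK⟩
  let Y : K := ⟨y, hyK⟩
  have li : LinearIndependent ℚ ![(1 : K), X, Y, X * Y] := by
    rw [Fintype.linearIndependent_iff]
    intro g hg
    have h1 := congrArg (algebraMap K ℂ) hg
    simp only [Fin.sum_univ_four, map_add, map_zero, Algebra.smul_def, map_mul] at h1
    have h2 : ((g 0 : ℚ) : ℂ) + g 1 * x + g 2 * y + g 3 * (x * y) = 0 := by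
      simpa [X, Y] using h1
    obtain ⟨h0, h1, h2, h3⟩ := indep4 x y A hx2 hx hy _ _ _ _ h2
    intro i
    fin_cases i <;> assumption
  let B := basisOfLinearIndependentOfCardEqFinrank li (by simp [hK])
  refine ⟨B.repr ⟨w, hw⟩ 0, B.repr ⟨w, hw⟩ 1, B.repr ⟨w, hw⟩ 2, B.repr ⟨w, hw⟩ 3, ?_⟩
  have h1 := congrArg (algebraMap K ℂ) (B.sum_repr ⟨w, hw⟩)
  generalize B.repr ⟨w, hw⟩ = g at h1
  simp only [Fin.sum_univ_four, map_add, Algebra.smul_def, map_mul] at h1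
  simpa [X, Y, B] using h1.symm

theorem prod_rat (x y z : ℂ) (A B C : ℚ) (hx2 : x ^ 2 = A) (hy2 : y ^ 2 = B) (hz2 : z ^ 2 = C)
    (hx : ∀ a : ℚ, x ≠ a) (hy0 : ∀ a : ℚ, y ≠ a)
    (hy : ∀ a b : ℚ, y ≠ a + b * x) (hzx : ∀ a b : ℚ, z ≠ a + b * x)
    (hzy : ∀ a b : ℚ, z ≠ a + b * y)
    (hz : ∃ a b c d : ℚ, z = a + b * x + c * y + d * (x * y)) :
    ∃ q : ℚ, x * y * z = q := by
  obtain ⟨a, b, c, d, h⟩ := hz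
  obtain ⟨-, h1, h2, h3⟩ := indep4 x y A hx2 hx hy
    (a ^ 2 + b ^ 2 * A + c ^ 2 * B + d ^ 2 * A * B - C) (2 * (a * b + c * d * B))
    (2 * (a * c + b * d * A)) (2 * (a * d + b * c)) (by
      push_cast
      rw [← hz2, ← hx2, ← hy2, h]
      ring)
  have hA : A ≠ 0 := by
    rintro rfl
    apply hx 0
    simpa using hx2
  have hB : ∀ s : ℚ, B ≠ s ^ 2 := by
    rintro s rfl
    push_cast at hy2
    rcases sq_eq_sq_iff_eq_or_eq_neg.mp hy2 with h | h
    · exact hy0 s h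
    · exact hy0 (-s) (by simpa using h)
  have hbc : ¬ (b = 0 ∧ d = 0) := by
    rintro ⟨rfl, rfl⟩
    exact hzy a c (by simpa using h)
  have hcd : ¬ (c = 0 ∧ d = 0) := by
    rintro ⟨rfl, rfl⟩
    exact hzx a b (by simpa using h)
  have hd : d ≠ 0 := by
    rintro rfl
    have : b * c = 0 := by linarith
    rcases mul_eq_zero.mp this with h | h
    · exact hbc ⟨h, rfl⟩
    · exact hcd ⟨h, rfl⟩
  have hc : c = 0 := by
    by_contra hc
    apply hB (b / d)
    field_simp
    have : c * (B * d ^ 2 - b ^ 2) = 0 := by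
      linear_combination (d / 2) * h1 - (b / 2) * h3
    rcases mul_eq_zero.mp this with h | h
    · exact absurd h hc
    · linarith
  subst hc
  have ha : a = 0 := by
    have : a * d = 0 := by linarith
    exact (mul_eq_zero.mp this).resolve_right hd
  subst ha
  have hb : b = 0 := by
    have : b * (d * A) = 0 := by linarith
    exact (mul_eq_zero.mp this).resolve_right (mul_ne_zero hd hA)
  subst hb
  refine ⟨d * A * B, ?_⟩
  push_cast
  rw [h, ← hx2, ← hy2]
  push_cast
  ring

/-- If `K, K′` are totally real `V₄`-quartic subfields of `ℂ`, with
quadratic-subfield discriminants `(Δ₁, Δ₂, Δ₃)` and `(Δ′₁, Δ′₂, Δ′₃)` each labeled in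
increasing order, and if there is a real `λ > 0` with `Δ′ᵢ = λ·Δᵢ` for `i = 1, 2, 3`,
then `K = K′`. -/
theorem stmt13 (K K' : IntermediateField ℚ ℂ)
    (hK : IsV4Quartic K) (hK' : IsV4Quartic K')
    (hreal : IsTotallyRealSubfield K) (hreal' : IsTotallyRealSubfield K')
    (F₁ F₂ F₃ F₁' F₂' F₃' : IntermediateField ℚ ℂ)
    (hd : F₁ ≠ F₂ ∧ F₁ ≠ F₃ ∧ F₂ ≠ F₃)
    (hd' : F₁' ≠ F₂' ∧ F₁' ≠ F₃' ∧ F₂' ≠ F₃')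
    (hq : IsQuadSubfield K F₁ ∧ IsQuadSubfield K F₂ ∧ IsQuadSubfield K F₃)
    (hq' : IsQuadSubfield K' F₁' ∧ IsQuadSubfield K' F₂' ∧ IsQuadSubfield K' F₃')
    (hord : quartDisc F₁ ≤ quartDisc F₂ ∧ quartDisc F₂ ≤ quartDisc F₃)
    (hord' : quartDisc F₁' ≤ quartDisc F₂' ∧ quartDisc F₂' ≤ quartDisc F₃')
    (lam : ℝ) (hlam : 0 < lam)
    (hprop : (quartDisc F₁' : ℝ) = lam * (quartDisc F₁ : ℝ) ∧
             (quartDisc F₂' : ℝ) = lam * (quartDisc F₂ : ℝ) ∧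
             (quartDisc F₃' : ℝ) = lam * (quartDisc F₃ : ℝ)) :
    K = K' := by
  obtain ⟨⟨hF₁, hf₁⟩, ⟨hF₂, hf₂⟩, ⟨hF₃, hf₃⟩⟩ := hq
  obtain ⟨⟨hF₁', hf₁'⟩, ⟨hF₂', hf₂'⟩, ⟨hF₃', hf₃'⟩⟩ := hq'
  obtain ⟨d12, d13, d23⟩ := hd
  obtain ⟨d12', d13', d23'⟩ := hd'
  obtain ⟨x, hxF, hx2, hx, hxs⟩ := quad_gen_sub F₁ hf₁
  obtain ⟨y, hyF, hy2, hy, hys⟩ := quad_gen_sub F₂ hf₂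
  obtain ⟨z, hzF, hz2, hz, hzs⟩ := quad_gen_sub F₃ hf₃
  obtain ⟨x', hxF', hx2', hx', hxs'⟩ := quad_gen_sub F₁' hf₁'
  obtain ⟨y', hyF', hy2', hy', hys'⟩ := quad_gen_sub F₂' hf₂'
  obtain ⟨z', hzF', hz2', hz', hzs'⟩ := quad_gen_sub F₃' hf₃'
  have hyx := quad_ne F₁ F₂ hf₁ hf₂ d12 x y hxF hys
  have hyx' := quad_ne F₁' F₂' hf₁' hf₂' d12' x' y' hxF' hys'
  obtain ⟨q, hq⟩ := prod_rat x y z _ _ _ hx2 hy2 hz2 hx hy hyx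
    (quad_ne F₁ F₃ hf₁ hf₃ d13 x z hxF hzs) (quad_ne F₂ F₃ hf₂ hf₃ d23 y z hyF hzs)
    (span4 K hK.1 x y (hF₁ hxF) (hF₂ hyF) _ hx2 hx hyx z (hF₃ hzF))
  obtain ⟨q', hq'⟩ := prod_rat x' y' z' _ _ _ hx2' hy2' hz2' hx' hy' hyx'
    (quad_ne F₁' F₃' hf₁' hf₃' d13' x' z' hxF' hzs')
    (quad_ne F₂' F₃' hf₂' hf₃' d23' y' z' hyF' hzs')
    (span4 K' hK'.1 x' y' (hF₁' hxF') (hF₂' hyF') _ hx2' hx' hyx' z' (hF₃' hzF'))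
  have nz : ∀ (w : ℂ), (∀ a : ℚ, w ≠ a) → w ≠ 0 := fun w hw h => hw 0 (by simpa using h)
  have hΔ : (quartDisc F₁ : ℚ) ≠ 0 := by
    intro h
    rw [h] at hx2
    exact nz x hx (by simpa using hx2)
  have hΔR : (quartDisc F₁ : ℝ) ≠ 0 := by exact_mod_cast hΔ
  -- the ratio is rational
  let l : ℚ := quartDisc F₁' / quartDisc F₁
  have hl : lam = (l : ℝ) := by
    simp only [l]
    push_cast
    rw [hprop.1]
    field_simp
  have hl0 : l ≠ 0 := by
    intro h
    rw [h] at hl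
    simp [hl] at hlam
  obtain ⟨p1, p2, p3⟩ := hprop
  rw [hl] at p1 p2 p3
  have p1 : (quartDisc F₁' : ℚ) = l * quartDisc F₁ := by exact_mod_cast p1
  have p2 : (quartDisc F₂' : ℚ) = l * quartDisc F₂ := by exact_mod_cast p2
  have p3 : (quartDisc F₃' : ℚ) = l * quartDisc F₃ := by exact_mod_cast p3
  rw [p1, Rat.cast_mul, ← hx2] at hx2'
  rw [p2, Rat.cast_mul, ← hy2] at hy2'
  rw [p3, Rat.cast_mul, ← hz2] at hz2'
  have hq0 : (q : ℂ) ≠ 0 := by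
    rw [← hq]
    exact mul_ne_zero (mul_ne_zero (nz x hx) (nz y hy)) (nz z hz)
  have hl0C : (l : ℂ) ≠ 0 := by exact_mod_cast hl0
  -- the ratio is a rational square
  have hsq : (l : ℂ) = (q' / (q * l)) ^ 2 := by
    have e : (q' : ℂ) ^ 2 = l ^ 3 * q ^ 2 := by
      rw [← hq, ← hq']
      calc (x' * y' * z') ^ 2 = x' ^ 2 * y' ^ 2 * z' ^ 2 := by ring
        _ = _ := by rw [hx2', hy2', hz2']; ring
    rw [div_pow, e]
    field_simp
  have mem : ∀ w w' : ℂ, w ∈ K → w' ^ 2 = l * w ^ 2 → w' ∈ K := by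
    intro w w' hw h
    rw [hsq, ← mul_pow] at h
    have hm : (q' / (q * l) : ℂ) * w ∈ K :=
      K.mul_mem (K.div_mem (rat_mem K _) (K.mul_mem (rat_mem K _) (rat_mem K _))) hw
    rcases sq_eq_sq_iff_eq_or_eq_neg.mp h with h | h
    · rw [h]; exact hm
    · rw [h]; exact K.neg_mem hm
  have hxK := mem x x' (hF₁ hxF) hx2'
  have hyK := mem y y' (hF₂ hyF) hy2'
  haveI : FiniteDimensional ℚ K := Module.finite_of_finrank_pos (by rw [hK.1]; norm_num)
  symm
  apply IntermediateField.eq_of_le_of_finrank_eq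
  · intro w hw
    obtain ⟨a, b, c, d, rfl⟩ := span4 K' hK'.1 x' y' (hF₁' hxF') (hF₂' hyF') (l * quartDisc F₁)
      (by rw [hx2', hx2, Rat.cast_mul]) hx' hyx' w hw
    exact K.add_mem (K.add_mem (K.add_mem (rat_mem _ _) (K.mul_mem (rat_mem _ _) hxK))
      (K.mul_mem (rat_mem _ _) hyK)) (K.mul_mem (rat_mem _ _) (K.mul_mem hxK hyK))
  · rw [hK.1, hK'.1]
end
end

section
/- Let K and K′ be V₄-quartic subfields of ℂ whose discriminants Δ_K and Δ_{K′} are both odd (i.e. both fields are tamely ramified). Let (Δ₁, Δ₂, Δ₃) and (Δ′₁, Δ′₂, Δ′₃) be the discriminants of the three quadratic subfields of K and of K′ respectively, each triple labeled so that |Δ₁| ≤ |Δ₂| ≤ |Δ₃| and |Δ′₁| ≤ |Δ′₂| ≤ |Δ′₃|. If there exists a real λ > 0 with |Δ′ᵢ| = λ·|Δᵢ| for i = 1, 2, 3, then K = K′. -/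
noncomputable section

section helpers
open NumberField

lemma aux_unit (D1 D2 D3 : ℤ) (h1 : Squarefree D1) (h2 : Squarefree D2) (h3 : Squarefree D3)
    (m : ℤ) (hm : D1 * D2 * D3 = m ^ 2) (r : ℤ)
    (k1 : r ∣ D1) (k2 : r ∣ D2) (k3 : r ∣ D3) : IsUnit r := by
  by_contra hr
  obtain ⟨p, hp, hpr⟩ := Int.exists_prime_and_dvd (n := r) (by rwa [Int.isUnit_iff_natAbs_eq] at hr)
  obtain ⟨e1, rfl⟩ := hpr.trans k1
  obtain ⟨e2, rfl⟩ := hpr.trans k2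
  obtain ⟨e3, rfl⟩ := hpr.trans k3
  have key : ∀ e, Squarefree (p * e) → ¬ p ∣ e := fun e he hpe =>
    hp.not_isUnit (he p (mul_dvd_mul_left p hpe))
  have : p ∣ m := hp.dvd_of_dvd_pow (n := 2) (hm ▸ ⟨e1 * (p * e2) * (p * e3), by ring⟩)
  obtain ⟨n, rfl⟩ := this
  have h : p * (e1 * e2 * e3) = n ^ 2 := by
    apply mul_left_cancel₀ (pow_ne_zero 2 hp.ne_zero)
    linear_combination hm
  have : p ∣ n := hp.dvd_of_dvd_pow (n := 2) (h ▸ ⟨_, rfl⟩)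
  obtain ⟨l, rfl⟩ := this
  have h' : e1 * e2 * e3 = p * l ^ 2 := by
    apply mul_left_cancel₀ hp.ne_zero
    linear_combination h
  have : p ∣ e1 * e2 * e3 := h' ▸ ⟨_, rfl⟩
  rcases hp.dvd_or_dvd this with h | h
  · rcases hp.dvd_or_dvd h with h | h
    · exact key _ h1 h
    · exact key _ h2 h
  · exact key _ h3 h

/-- proportional squarefree triples are equal up to sign -/
lemma aux_abs (D1 D2 D3 E1 E2 E3 : ℤ) (h1 : Squarefree D1) (h2 : Squarefree D2)
    (h3 : Squarefree D3) (g1 : Squarefree E1) (g2 : Squarefree E2) (g3 : Squarefree E3)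
    (m n : ℤ) (hm : D1 * D2 * D3 = m ^ 2) (hn : E1 * E2 * E3 = n ^ 2)
    (lam : ℝ) (hlam : 0 < lam) (k1 : (|E1| : ℝ) = lam * (|D1| : ℝ)) (k2 : (|E2| : ℝ) = lam * (|D2| : ℝ))
    (k3 : (|E3| : ℝ) = lam * (|D3| : ℝ)) : |E1| = |D1| ∧ |E2| = |D2| ∧ |E3| = |D3| := by
  have hD1 : (0:ℝ) < |(D1:ℝ)| := abs_pos.2 (by exact_mod_cast h1.ne_zero)
  obtain ⟨q, rfl⟩ : ∃ q : ℚ, lam = q := ⟨|E1| / |D1|, by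
    push_cast; rw [eq_div_iff hD1.ne']; exact k1.symm⟩
  have hq : 0 < q := by exact_mod_cast hlam
  have hqn : 0 < q.num := Rat.num_pos.2 hq
  have conv : ∀ E D : ℤ, (|E| : ℝ) = q * (|D| : ℝ) → q.den * |E| = q.num * |D| := by
    intro E D h
    have h' : ((|E| : ℤ) : ℚ) = q * (|D| : ℤ) := by exact_mod_cast h
    have : (q.den : ℚ) * (|E| : ℤ) = q.num * (|D| : ℤ) := by
      rw [h', ← Rat.mul_den_eq_num q]; ring
    exact_mod_cast this
  have c1 := conv _ _ k1
  have c2 := conv _ _ k2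
  have c3 := conv _ _ k3
  have cop : IsCoprime q.num (q.den : ℤ) := by
    rw [Int.isCoprime_iff_gcd_eq_one]; exact q.reduced
  have dE : ∀ E D : ℤ, q.den * |E| = q.num * |D| → q.num ∣ E := fun E D h =>
    (dvd_abs _ _).1 (cop.dvd_of_dvd_mul_left (h ▸ ⟨_, rfl⟩))
  have dD : ∀ E D : ℤ, q.den * |E| = q.num * |D| → (q.den : ℤ) ∣ D := fun E D h =>
    (dvd_abs _ _).1 (cop.symm.dvd_of_dvd_mul_left (h ▸ ⟨_, rfl⟩))
  have u1 := aux_unit E1 E2 E3 g1 g2 g3 n hn q.num (dE _ _ c1) (dE _ _ c2) (dE _ _ c3)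
  have u2 := aux_unit D1 D2 D3 h1 h2 h3 m hm q.den (dD _ _ c1) (dD _ _ c2) (dD _ _ c3)
  have e1 : q.num = 1 := by rcases Int.isUnit_iff.1 u1 with h | h <;> omega
  have e2 : (q.den : ℤ) = 1 := by rcases Int.isUnit_iff.1 u2 with h | h <;> omega
  rw [e1, e2] at c1 c2 c3
  simpa only [one_mul] using And.intro c1 (And.intro c2 c3)

lemma quad_exists_conj (F : Type*) [Field F] [NumberField F] (h2 : Module.finrank ℚ F = 2) :
    ∃ σ : F ≃ₐ[ℚ] F, (∀ x, σ (σ x) = x) ∧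
      (∀ x, algebraMap ℚ F (Algebra.trace ℚ F x) = x + σ x) ∧
      (∀ x, algebraMap ℚ F (Algebra.norm ℚ x) = x * σ x) := by
  classical
  have : Algebra.IsQuadraticExtension ℚ F := ⟨h2⟩
  have hc : Nat.card (F ≃ₐ[ℚ] F) = 2 := by rw [IsGalois.card_aut_eq_finrank, h2]
  have : Nontrivial (F ≃ₐ[ℚ] F) := by
    rw [← Finite.one_lt_card_iff_nontrivial]; omega
  obtain ⟨σ, hσ⟩ := exists_ne (1 : F ≃ₐ[ℚ] F)
  have hu : (Finset.univ : Finset (F ≃ₐ[ℚ] F)) = {1, σ} := by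
    symm
    apply Finset.eq_univ_of_card
    rw [Finset.card_pair hσ.symm, ← Nat.card_eq_fintype_card, hc]
  refine ⟨σ, ?_, ?_, ?_⟩
  · intro x
    have : σ ^ 2 = 1 := by rw [← hc]; exact pow_card_eq_one'
    have h := congrArg (fun f : F ≃ₐ[ℚ] F => f x) this
    simpa [pow_two] using h
  · intro x
    rw [trace_eq_sum_automorphisms, hu, Finset.sum_pair hσ.symm]; rfl
  · intro x
    rw [Algebra.norm_eq_prod_automorphisms, hu, Finset.prod_pair hσ.symm]; rfl

lemma quad_discr (F : Type*) [Field F] [NumberField F] (σ : F ≃ₐ[ℚ] F)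
    (htr : ∀ x, algebraMap ℚ F (Algebra.trace ℚ F x) = x + σ x) (b : Fin 2 → 𝓞 F) :
    ((Algebra.discr ℤ b : ℤ) : F) = ((b 0 : F) * σ (b 1) - σ (b 0) * b 1) ^ 2 := by
  have ht : ∀ x : 𝓞 F, ((Algebra.trace ℤ (𝓞 F) x : ℤ) : F) = x + σ x := by
    intro x
    rw [← htr, ← Algebra.coe_trace_int]; simp
  rw [Algebra.discr_def, Matrix.det_fin_two]
  simp only [Algebra.traceMatrix_apply, Algebra.traceForm_apply]
  push_cast
  simp only [ht]
  push_cast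
  simp only [map_mul]
  ring

lemma quad_main (F : Type*) [Field F] [NumberField F] (h2 : Module.finrank ℚ F = 2)
    (hodd : Odd (discr F)) :
    Squarefree (discr F) ∧ discr F % 4 = 1 ∧
      ∃ r : F, r ^ 2 = (discr F : F) ∧ ∀ q : ℚ, r ≠ algebraMap ℚ F q := by
  classical
  obtain ⟨σ, hσ, htr, hnm⟩ := quad_exists_conj F h2
  have hr2 : Module.finrank ℤ (𝓞 F) = 2 := by rw [RingOfIntegers.rank, h2]
  let b : Module.Basis (Fin 2) ℤ (𝓞 F) := Module.finBasisOfFinrankEq ℤ (𝓞 F) hr2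
  have hD : Algebra.discr ℤ b = discr F := discr_eq_discr F b
  have hDr := quad_discr F σ htr b
  rw [hD] at hDr
  set r : F := (b 0 : F) * σ (b 1) - σ (b 0) * b 1 with hr
  have hσr : σ r = - r := by simp [hr, hσ]
  have hD0 : discr F ≠ 0 := discr_ne_zero F
  have hr0 : r ≠ 0 := by
    rintro h; rw [h] at hDr
    apply hD0
    have : (discr F : F) = 0 := by rw [hDr]; ring
    exact_mod_cast this
  have hint : ∀ x : F, IsIntegral ℤ x → ∃ t n : ℤ, (t : F) = x + σ x ∧ (n : F) = x * σ x := by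
    intro x hx
    refine ⟨Algebra.trace ℤ (𝓞 F) ⟨x, hx⟩, Algebra.norm ℤ (⟨x, hx⟩ : 𝓞 F), ?_, ?_⟩
    · have h := Algebra.coe_trace_int (⟨x, hx⟩ : 𝓞 F)
      rw [← htr]
      refine Eq.trans ?_ (congrArg (algebraMap ℚ F) h)
      simp
    · have h := Algebra.coe_norm_int (⟨x, hx⟩ : 𝓞 F)
      rw [← hnm]
      refine Eq.trans ?_ (congrArg (algebraMap ℚ F) h)
      simp
      rfl
  have hbi : ∀ i, IsIntegral ℤ (b i : F) := fun i => RingOfIntegers.isIntegral_coe _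
  have hσi : ∀ x : F, IsIntegral ℤ x → IsIntegral ℤ (σ x) := fun x hx =>
    hx.map (σ.toAlgHom.restrictScalars ℤ)
  have hmod : discr F % 4 = 1 := by
    obtain ⟨t, n, ht, hn⟩ := hint ((b 0 : F) * σ (b 1)) ((hbi 0).mul (hσi _ (hbi 1)))
    have h1 : discr F = t ^ 2 - 4 * n := by
      have : (discr F : F) = ((t ^ 2 - 4 * n : ℤ) : F) := by
        push_cast
        rw [hDr, ht, hn, hr]
        simp only [map_mul, hσ]
        ring
      exact_mod_cast this
    rcases Int.even_or_odd' t with ⟨k, rfl | rfl⟩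
    · exfalso
      rw [h1] at hodd
      exact (Int.not_even_iff_odd.2 hodd) ⟨2 * k ^ 2 - 2 * n, by ring⟩
    · have : discr F = 1 + 4 * (k ^ 2 + k - n) := by rw [h1]; ring
      omega
  refine ⟨?_, hmod, r, hDr.symm, ?_⟩
  · rintro p ⟨e, he⟩
    have hp : Odd p := by
      rw [he] at hodd
      exact (Int.odd_mul.1 (Int.odd_mul.1 hodd).1).1
    have hp0 : p ≠ 0 := by rintro rfl; simp at he; exact hD0 he
    have he4 : e % 4 = 1 := by
      obtain ⟨k, rfl⟩ := hp
      have : discr F = e + 4 * ((k ^ 2 + k) * e) := by rw [he]; ring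
      omega
    have hpF : (p : F) ≠ 0 := by exact_mod_cast hp0
    obtain ⟨k, hk⟩ : ∃ k, e = 1 + 4 * k := ⟨e / 4, by omega⟩
    set w : F := (1 + r / p) / 2 with hw
    have hrp : (r / p) ^ 2 = (e : F) := by
      rw [div_pow, ← hDr, he]; push_cast; field_simp
    have hwi : IsIntegral ℤ w := by
      refine ⟨Polynomial.X ^ 2 - Polynomial.X - Polynomial.C k, ?_, ?_⟩
      · monicity!
      · have hck : Polynomial.eval₂ (algebraMap ℤ F) w (Polynomial.C k) = (k : F) := by
          rw [Polynomial.eval₂_C]; simp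
        have : (e : F) = 1 + 4 * (k : F) := by rw [hk]; push_cast; ring
        simp only [Polynomial.eval₂_sub, Polynomial.eval₂_pow, Polynomial.eval₂_X,
          hck]
        rw [hw]
        linear_combination (1/4 : F) * hrp + (1/4 : F) * this
    let v : Fin 2 → 𝓞 F := ![1, ⟨w, hwi⟩]
    have hv := quad_discr F σ htr v
    have hv' : Algebra.discr ℤ v = e := by
      have : ((Algebra.discr ℤ v : ℤ) : F) = (e : F) := by
        rw [hv, ← hrp]
        have a0 : ((v 0 : 𝓞 F) : F) = 1 := rfl
        have a1 : ((v 1 : 𝓞 F) : F) = w := rfl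
        rw [a0, a1, hw]
        have h2' : σ (2 : F) = 2 := map_ofNat σ 2
        simp only [map_div₀, map_add, map_one, hσr, h2', map_intCast]
        ring
      exact_mod_cast this
    have hm := Algebra.discr_of_matrix_vecMul b (b.toMatrix v)
    rw [Module.Basis.toMatrix_map_vecMul, hv', hD, he] at hm
    have he0 : e ≠ 0 := by rintro rfl; omega
    have : (b.toMatrix v).det ^ 2 * p * p = 1 := by
      apply mul_right_cancel₀ he0
      linear_combination -hm
    exact IsUnit.of_mul_eq_one _ (by rw [mul_comm]; exact this)
  · intro q hq
    rw [hq, AlgEquiv.commutes] at hσr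
    have := self_eq_neg.1 hσr
    rw [← hq] at this
    exact hr0 this

lemma quartDisc_eq (K : IntermediateField ℚ ℂ) [NumberField K] : quartDisc K = discr K := by
  unfold quartDisc
  rw [dif_pos (inferInstance : FiniteDimensional ℚ K)]

lemma numField_of (K : IntermediateField ℚ ℂ) (h : Module.finrank ℚ K ≠ 0) : NumberField K := by
  have : FiniteDimensional ℚ K := Module.finite_of_finrank_pos (Nat.pos_of_ne_zero h)
  have : CharZero K := charZero_of_injective_algebraMap (algebraMap ℚ K).injective
  exact ⟨⟩

open IntermediateField in
lemma sub_main (K F : IntermediateField ℚ ℂ) (hK : IsV4Quartic K) (hodd : Odd (quartDisc K))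
    (hF : IsQuadSubfield K F) :
    Squarefree (quartDisc F) ∧ quartDisc F % 4 = 1 ∧
      ∃ r : ℂ, r ∈ K ∧ r ^ 2 = (quartDisc F : ℂ) ∧ F = ℚ⟮r⟯ ∧ ∀ q : ℚ, r ≠ q := by
  obtain ⟨hle, h2⟩ := hF
  have : NumberField K := numField_of K (by rw [hK.1]; norm_num)
  have : NumberField F := numField_of F (by rw [h2]; norm_num)
  let _ : Algebra F K := (IntermediateField.inclusion hle).toRingHom.toAlgebra
  have hdvd : discr F ∣ discr K := discr_dvd_discr F K
  rw [quartDisc_eq] at hodd ⊢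
  obtain ⟨h1, h4, r, hr, hq⟩ := quad_main F h2 (by
    obtain ⟨c, hc⟩ := hdvd
    rw [hc] at hodd
    exact (Int.odd_mul.1 hodd).1)
  refine ⟨h1, h4, r, hle r.2, ?_, ?_, ?_⟩
  · have := congrArg (algebraMap F ℂ) hr
    simpa using this
  · have hrq : ∀ q : ℚ, (r : ℂ) ≠ q := by
      intro q h
      exact hq q (Subtype.ext (by simpa using h))
    symm
    have hle' : ℚ⟮(r : ℂ)⟯ ≤ F := by
      rw [adjoin_simple_le_iff]; exact r.2
    have hm := finrank_bot_mul_relfinrank hle'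
    rw [h2] at hm
    have hdv : Module.finrank ℚ ℚ⟮(r : ℂ)⟯ ∣ 2 := ⟨_, hm.symm⟩
    rcases (Nat.dvd_prime Nat.prime_two).1 hdv with h | h
    · exfalso
      rw [IntermediateField.finrank_eq_one_iff] at h
      have hmem : (r : ℂ) ∈ (⊥ : IntermediateField ℚ ℂ) := h ▸ mem_adjoin_simple_self ℚ (r : ℂ)
      obtain ⟨q, hq'⟩ := mem_bot.1 hmem
      exact hrq q (by simpa using hq'.symm)
    · rw [h] at hm
      exact le_antisymm hle' (relfinrank_eq_one_iff.1 (by omega))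
  · intro q h
    exact hq q (Subtype.ext (by simpa using h))

lemma v4_gen (K : IntermediateField ℚ ℂ) (hK : IsV4Quartic K) :
    ∃ σ τ : K ≃ₐ[ℚ] K, ∀ x : K, σ x = x → τ x = x → ∃ q : ℚ, (x : ℂ) = q := by
  obtain ⟨h4, hG, ⟨e⟩⟩ := hK
  have : FiniteDimensional ℚ K := Module.finite_of_finrank_pos (by rw [h4]; norm_num)
  refine ⟨e.symm (Multiplicative.ofAdd (1, 0)), e.symm (Multiplicative.ofAdd (0, 1)), ?_⟩
  intro x h1 h2
  have : x ∈ Set.range (algebraMap ℚ K) := by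
    rw [IsGalois.mem_range_algebraMap_iff_fixed]
    intro f
    have key : ∀ v : ZMod 2 × ZMod 2, v = 0 ∨ v = (1, 0) ∨ v = (0, 1) ∨ v = (1, 0) + (0, 1) := by
      decide
    have hf : f = e.symm (Multiplicative.ofAdd (Multiplicative.toAdd (e f))) := by simp
    rcases key (Multiplicative.toAdd (e f)) with h | h | h | h
    · rw [hf, h]; simp
    · rw [hf, h]; exact h1
    · rw [hf, h]; exact h2
    · rw [hf, h, ofAdd_add, map_mul, AlgEquiv.mul_apply, h2, h1]
  obtain ⟨q, rfl⟩ := this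
  exact ⟨q, by simp⟩

lemma v4_prod (K : IntermediateField ℚ ℂ) (hK : IsV4Quartic K) (r₁ r₂ r₃ : ℂ)
    (m₁ : r₁ ∈ K) (m₂ : r₂ ∈ K) (m₃ : r₃ ∈ K) (d₁ d₂ d₃ : ℤ)
    (s₁ : r₁ ^ 2 = d₁) (s₂ : r₂ ^ 2 = d₂) (s₃ : r₃ ^ 2 = d₃)
    (n₁ : ∀ q : ℚ, r₁ ≠ q) (n₂ : ∀ q : ℚ, r₂ ≠ q) (n₃ : ∀ q : ℚ, r₃ ≠ q)
    (n₁₂ : ∀ q : ℚ, r₁ * r₂ ≠ q) (n₁₃ : ∀ q : ℚ, r₁ * r₃ ≠ q) (n₂₃ : ∀ q : ℚ, r₂ * r₃ ≠ q) :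
    ∃ q : ℚ, r₁ * r₂ * r₃ = q := by
  obtain ⟨σ, τ, h⟩ := v4_gen K hK
  have sgn : ∀ (f : K ≃ₐ[ℚ] K) (x : K) (d : ℤ), (x : ℂ) ^ 2 = d → f x = x ∨ f x = - x := by
    intro f x d hx
    have hx' : x ^ 2 = (d : K) := Subtype.ext (by simpa using hx)
    have := congrArg f hx'
    rw [map_pow, map_intCast, ← hx'] at this
    exact sq_eq_sq_iff_eq_or_eq_neg.1 this
  lift r₁ to K using m₁
  lift r₂ to K using m₂
  lift r₃ to K using m₃
  have a1 := sgn σ r₁ _ s₁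
  have a2 := sgn σ r₂ _ s₂
  have a3 := sgn σ r₃ _ s₃
  have b1 := sgn τ r₁ _ s₁
  have b2 := sgn τ r₂ _ s₂
  have b3 := sgn τ r₃ _ s₃
  have k1 : ¬ (σ r₁ = r₁ ∧ τ r₁ = r₁) := fun ⟨u, v⟩ => (h _ u v).elim n₁
  have k2 : ¬ (σ r₂ = r₂ ∧ τ r₂ = r₂) := fun ⟨u, v⟩ => (h _ u v).elim n₂
  have k3 : ¬ (σ r₃ = r₃ ∧ τ r₃ = r₃) := fun ⟨u, v⟩ => (h _ u v).elim n₃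
  have k12 : ¬ (σ (r₁ * r₂) = r₁ * r₂ ∧ τ (r₁ * r₂) = r₁ * r₂) := fun ⟨u, v⟩ =>
    (h _ u v).elim (by simpa using n₁₂)
  have k13 : ¬ (σ (r₁ * r₃) = r₁ * r₃ ∧ τ (r₁ * r₃) = r₁ * r₃) := fun ⟨u, v⟩ =>
    (h _ u v).elim (by simpa using n₁₃)
  have k23 : ¬ (σ (r₂ * r₃) = r₂ * r₃ ∧ τ (r₂ * r₃) = r₂ * r₃) := fun ⟨u, v⟩ =>
    (h _ u v).elim (by simpa using n₂₃)
  have main : σ (r₁ * r₂ * r₃) = r₁ * r₂ * r₃ ∧ τ (r₁ * r₂ * r₃) = r₁ * r₂ * r₃ := by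
    simp only [map_mul] at *
    rcases a1 with a1 | a1 <;> rcases a2 with a2 | a2 <;> rcases a3 with a3 | a3 <;>
    rcases b1 with b1 | b1 <;> rcases b2 with b2 | b2 <;> rcases b3 with b3 | b3 <;>
    simp only [a1, a2, a3, b1, b2, b3, neg_mul, mul_neg, neg_neg, and_self, true_and,
      not_true_eq_false] at k1 k2 k3 k12 k13 k23 ⊢
  simpa using h _ main.1 main.2

open IntermediateField in
lemma adj_le (r s : ℂ) (d : ℤ) (hd : s ^ 2 = d) (hs : s ≠ 0) (q : ℚ) (h : r * s = q) :
    ℚ⟮r⟯ ≤ ℚ⟮s⟯ := by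
  rw [adjoin_simple_le_iff]
  have : r = algebraMap ℚ ℂ (q / d) * s := by
    have hd0 : (d : ℂ) ≠ 0 := by rw [← hd]; exact pow_ne_zero 2 hs
    simp only [map_div₀, eq_ratCast, Rat.cast_intCast]
    field_simp
    rw [← hd, ← h]; ring
  rw [this]
  exact mul_mem (IntermediateField.algebraMap_mem _ _) (mem_adjoin_simple_self ℚ s)

open IntermediateField in
lemma adj_ne (r s : ℂ) (d e : ℤ) (hr : r ^ 2 = d) (hs : s ^ 2 = e) (hr0 : ∀ q : ℚ, r ≠ q)
    (hs0 : ∀ q : ℚ, s ≠ q) (hne : ℚ⟮r⟯ ≠ ℚ⟮s⟯) (q : ℚ) : r * s ≠ q := by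
  intro h
  have r0 : r ≠ 0 := by simpa using hr0 0
  have s0 : s ≠ 0 := by simpa using hs0 0
  exact hne (le_antisymm (adj_le r s e hs s0 q h) (adj_le s r d hr r0 q (by rw [mul_comm]; exact h)))

open IntermediateField in
lemma adj_eq (r s : ℂ) (h : r ^ 2 = s ^ 2) : ℚ⟮r⟯ = ℚ⟮s⟯ := by
  rcases sq_eq_sq_iff_eq_or_eq_neg.1 h with h | h
  · rw [h]
  · rw [h]
    apply le_antisymm <;> rw [adjoin_simple_le_iff]
    · exact neg_mem (mem_adjoin_simple_self ℚ s)
    · simpa using neg_mem (mem_adjoin_simple_self ℚ (-s))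

lemma int_sq (a : ℤ) (q : ℚ) (h : (a : ℚ) = q ^ 2) : ∃ m : ℤ, a = m ^ 2 := by
  have hi : IsIntegral ℤ q := IsIntegral.of_pow (n := 2) (by norm_num)
    (by rw [← h]; exact isIntegral_algebraMap (R := ℤ) (x := a))
  obtain ⟨m, rfl⟩ := IsIntegrallyClosed.isIntegral_iff.1 hi
  exact ⟨m, by simp at h; exact_mod_cast h⟩

lemma K_eq_sup (K F₁ F₂ : IntermediateField ℚ ℂ) (hK : IsV4Quartic K)
    (h1 : IsQuadSubfield K F₁) (h2 : IsQuadSubfield K F₂) (hne : F₁ ≠ F₂) : K = F₁ ⊔ F₂ := by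
  have : FiniteDimensional ℚ K := Module.finite_of_finrank_pos (by rw [hK.1]; norm_num)
  have hle : F₁ ⊔ F₂ ≤ K := sup_le h1.1 h2.1
  have e1 := IntermediateField.finrank_bot_mul_relfinrank hle
  have e2 := IntermediateField.finrank_bot_mul_relfinrank (le_sup_left : F₁ ≤ F₁ ⊔ F₂)
  rw [← e2, h1.2, hK.1] at e1
  have hdv : F₁.relfinrank (F₁ ⊔ F₂) ∣ 2 := ⟨(F₁ ⊔ F₂).relfinrank K, by linarith⟩
  rcases (Nat.dvd_prime Nat.prime_two).1 hdv with h | h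
  · exfalso
    have hle2 : F₂ ≤ F₁ := le_sup_right.trans (IntermediateField.relfinrank_eq_one_iff.1 h)
    have : FiniteDimensional ℚ F₁ := Module.finite_of_finrank_pos (by rw [h1.2]; norm_num)
    exact hne (IntermediateField.eq_of_le_of_finrank_eq hle2 (by rw [h1.2, h2.2])).symm
  · rw [h] at e1
    exact le_antisymm (IntermediateField.relfinrank_eq_one_iff.1 (by omega)) hle

/-- all the data for one field -/
lemma v4_data (K F₁ F₂ F₃ : IntermediateField ℚ ℂ) (hK : IsV4Quartic K)
    (hodd : Odd (quartDisc K)) (hd : F₁ ≠ F₂ ∧ F₁ ≠ F₃ ∧ F₂ ≠ F₃)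
    (hq : IsQuadSubfield K F₁ ∧ IsQuadSubfield K F₂ ∧ IsQuadSubfield K F₃) :
    ∃ m : ℤ, quartDisc F₁ * quartDisc F₂ * quartDisc F₃ = m ^ 2 := by
  obtain ⟨-, -, r₁, m₁, s₁, e₁, n₁⟩ := sub_main K F₁ hK hodd hq.1
  obtain ⟨-, -, r₂, m₂, s₂, e₂, n₂⟩ := sub_main K F₂ hK hodd hq.2.1
  obtain ⟨-, -, r₃, m₃, s₃, e₃, n₃⟩ := sub_main K F₃ hK hodd hq.2.2
  obtain ⟨q, h⟩ := v4_prod K hK r₁ r₂ r₃ m₁ m₂ m₃ _ _ _ s₁ s₂ s₃ n₁ n₂ n₃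
    (adj_ne _ _ _ _ s₁ s₂ n₁ n₂ (e₁ ▸ e₂ ▸ hd.1)) (adj_ne _ _ _ _ s₁ s₃ n₁ n₃ (e₁ ▸ e₃ ▸ hd.2.1))
    (adj_ne _ _ _ _ s₂ s₃ n₂ n₃ (e₂ ▸ e₃ ▸ hd.2.2))
  apply int_sq _ q
  have : ((quartDisc F₁ : ℂ) * quartDisc F₂ * quartDisc F₃) = (q : ℂ) ^ 2 := by
    rw [← h, ← s₁, ← s₂, ← s₃]; ring
  exact_mod_cast this

lemma field_eq (K K' F F' : IntermediateField ℚ ℂ) (hK : IsV4Quartic K) (hK' : IsV4Quartic K')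
    (hodd : Odd (quartDisc K)) (hodd' : Odd (quartDisc K'))
    (hF : IsQuadSubfield K F) (hF' : IsQuadSubfield K' F')
    (h : |quartDisc F'| = |quartDisc F|) : F = F' := by
  obtain ⟨-, h4, r, -, s, e, -⟩ := sub_main K F hK hodd hF
  obtain ⟨-, h4', r', -, s', e', -⟩ := sub_main K' F' hK' hodd' hF'
  have : quartDisc F = quartDisc F' := by
    rcases abs_eq_abs.1 h with h | h <;> omega
  rw [e, e']
  apply adj_eq
  rw [s, s', this]

end helpers

/-- If `K, K′` are `V₄`-quartic subfields of `ℂ` with odd discriminants,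
with quadratic-subfield discriminants `(Δ₁, Δ₂, Δ₃)` and `(Δ′₁, Δ′₂, Δ′₃)` each labeled
in increasing order of absolute value, and if there is a real `λ > 0` with
`|Δ′ᵢ| = λ·|Δᵢ|` for `i = 1, 2, 3`, then `K = K′`. -/
theorem stmt14 (K K' : IntermediateField ℚ ℂ)
    (hK : IsV4Quartic K) (hK' : IsV4Quartic K')
    (htame : Odd (quartDisc K)) (htame' : Odd (quartDisc K'))
    (F₁ F₂ F₃ F₁' F₂' F₃' : IntermediateField ℚ ℂ)
    (hd : F₁ ≠ F₂ ∧ F₁ ≠ F₃ ∧ F₂ ≠ F₃)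
    (hd' : F₁' ≠ F₂' ∧ F₁' ≠ F₃' ∧ F₂' ≠ F₃')
    (hq : IsQuadSubfield K F₁ ∧ IsQuadSubfield K F₂ ∧ IsQuadSubfield K F₃)
    (hq' : IsQuadSubfield K' F₁' ∧ IsQuadSubfield K' F₂' ∧ IsQuadSubfield K' F₃')
    (hord : |quartDisc F₁| ≤ |quartDisc F₂| ∧ |quartDisc F₂| ≤ |quartDisc F₃|)
    (hord' : |quartDisc F₁'| ≤ |quartDisc F₂'| ∧ |quartDisc F₂'| ≤ |quartDisc F₃'|)
    (lam : ℝ) (hlam : 0 < lam)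
    (hprop : (|quartDisc F₁'| : ℝ) = lam * (|quartDisc F₁| : ℝ) ∧
             (|quartDisc F₂'| : ℝ) = lam * (|quartDisc F₂| : ℝ) ∧
             (|quartDisc F₃'| : ℝ) = lam * (|quartDisc F₃| : ℝ)) :
    K = K' := by
  obtain ⟨m, hm⟩ := v4_data K F₁ F₂ F₃ hK htame hd hq
  obtain ⟨n, hn⟩ := v4_data K' F₁' F₂' F₃' hK' htame' hd' hq'
  obtain ⟨h1, h2, -⟩ := aux_abs _ _ _ _ _ _ (sub_main K F₁ hK htame hq.1).1
    (sub_main K F₂ hK htame hq.2.1).1 (sub_main K F₃ hK htame hq.2.2).1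
    (sub_main K' F₁' hK' htame' hq'.1).1
    (sub_main K' F₂' hK' htame' hq'.2.1).1 (sub_main K' F₃' hK' htame' hq'.2.2).1
    m n hm hn lam hlam hprop.1 hprop.2.1 hprop.2.2
  have e1 := field_eq K K' F₁ F₁' hK hK' htame htame' hq.1 hq'.1 h1
  have e2 := field_eq K K' F₂ F₂' hK hK' htame htame' hq.2.1 hq'.2.1 h2
  rw [K_eq_sup K F₁ F₂ hK hq.1 hq.2.1 hd.1, K_eq_sup K' F₁' F₂' hK' hq'.1 hq'.2.1 hd'.1, e1, e2]
end
end

section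
/- Suppose 0 < x₁ ≤ y₁, 0 < x₂ ≤ y₂ are real numbers, g is a 3×3 integer matrix with determinant ±1, and λ > 0 is a real number such that g · G_oC(x₁, y₁) · gᵀ = λ · G_oC(x₂, y₂) (matrix product over ℝ). Then x₁ = x₂, y₁ = y₂, and λ = 1. -/
open Matrix

/-- The Gram matrix `G_oC(x, y)` of a base-centered orthorhombic lattice. -/
noncomputable def GoC (x y : ℝ) : Matrix (Fin 3) (Fin 3) ℝ :=
  !![(x ^ 2 + y ^ 2) / 4, 0, (x ^ 2 - y ^ 2) / 4;
     0, 1, 0;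
     (x ^ 2 - y ^ 2) / 4, 0, (x ^ 2 + y ^ 2) / 4]

/-- Integer pairs with nonnegative products summing to four. -/
lemma aux_int (e U V S W : ℤ) (he : e = 1 ∨ e = -1) (hd : U * W - V * S = 4 * e)
    (h1 : 0 ≤ e * (U * W)) (h2 : 0 ≤ -e * (V * S))
    (hUW : U = 0 ↔ W = 0) (hVS : V = 0 ↔ S = 0)
    (p1 : Even (U + V)) (p2 : Even (U + S)) (p3 : Even (U + W)) :
    (U = e * W ∧ U ≠ 0) ∨ (V = -e * S ∧ V ≠ 0) := by
  have key : ∀ P Q : ℤ, P * Q = 1 → P = Q ∧ P ≠ 0 := by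
    intro P Q h
    rcases Int.mul_eq_one_iff_eq_one_or_neg_one.1 h with h | h <;> simp [h.1, h.2]
  have key4 : ∀ P Q : ℤ, P * Q = 4 → Even P → Even Q → P = Q ∧ P ≠ 0 := by
    rintro P Q h ⟨P', rfl⟩ ⟨Q', rfl⟩
    obtain ⟨a, b⟩ := key P' Q' (by linarith)
    constructor <;> omega
  have hee : e * e = 1 := by rcases he with rfl | rfl <;> norm_num
  have hsum : U * (e * W) + V * (-e * S) = 4 := by linear_combination e * hd + 4 * hee
  have hX : 0 ≤ U * (e * W) := by linarith
  have hX4 : U * (e * W) ≤ 4 := by linarith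
  have ee : Odd e := by rcases he with rfl | rfl <;> decide
  have e0 : e ≠ 0 := by rintro rfl; simp at hee
  generalize hX' : U * (e * W) = X at *
  have hY' : V * (-e * S) = 4 - X := by linarith
  have pX : Even X ↔ Even U := by
    have ne : ¬ Even e := Int.not_even_iff_odd.2 ee
    rw [Int.even_add] at p3
    rw [← hX', Int.even_mul, Int.even_mul, ← p3]
    tauto
  interval_cases X
  · right
    have hU : U = 0 := by
      rcases mul_eq_zero.1 hX' with h | h
      · exact h
      · exact hUW.2 ((mul_eq_zero.1 h).resolve_left e0)
    subst hU
    refine key4 _ _ (by linarith) (by simpa using p1) ?_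
    simp only [zero_add] at p2
    exact p2.mul_left _
  · left; exact key _ _ hX'
  · exfalso
    have hU : Even U := pX.1 (by decide)
    have hW : Even W := by rw [Int.even_add] at p3; tauto
    obtain ⟨a, rfl⟩ := hU
    obtain ⟨b, rfl⟩ := hW
    have : 2 * (a * (e * b)) = 1 := by linarith
    omega
  · right; exact key _ _ (by linarith)
  · left
    have hV : V = 0 := by
      have : V * (-e * S) = 0 := by linarith
      rcases mul_eq_zero.1 this with h | h
      · exact h
      · exact hVS.2 ((mul_eq_zero.1 h).resolve_left (neg_ne_zero.2 e0))
    subst hV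
    have hU : Even U := by simpa using p1
    refine key4 _ _ hX' hU ?_
    have hW : Even W := by rw [Int.even_add] at p3; tauto
    exact hW.mul_left _

/-- The planar case. -/
lemma aux_plane (A B A' B' : ℝ) (hA : 0 < A) (hB : 0 < B) (hA' : 0 < A') (hB' : 0 < B')
    (m n r s e : ℤ) (he : e = 1 ∨ e = -1) (hd : m * s - n * r = e)
    (q1 : A * (m + n) ^ 2 + B * (m - n) ^ 2 = A' + B')
    (q2 : A * (r + s) ^ 2 + B * (r - s) ^ 2 = A' + B')
    (q3 : A * (m + n) * (r + s) + B * (m - n) * (r - s) = A' - B') :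
    (A = A' ∧ B = B') ∨ (A = B' ∧ B = A') := by
  obtain ⟨U, hU⟩ : ∃ U, U = m + n + r + s := ⟨_, rfl⟩
  obtain ⟨V, hV⟩ : ∃ V, V = m - n + r - s := ⟨_, rfl⟩
  obtain ⟨S, hS⟩ : ∃ S, S = m + n - r - s := ⟨_, rfl⟩
  obtain ⟨W, hW⟩ : ∃ W, W = m - n - r + s := ⟨_, rfl⟩
  have hUr : (U : ℝ) = m + n + r + s := by rw [hU]; push_cast; ring
  have hVr : (V : ℝ) = m - n + r - s := by rw [hV]; push_cast; ring
  have hSr : (S : ℝ) = m + n - r - s := by rw [hS]; push_cast; ring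
  have hWr : (W : ℝ) = m - n - r + s := by rw [hW]; push_cast; ring
  have det : U * W - V * S = 4 * (e) ∨ U * W - V * S = 4 * (-e) := by
    first
    | left; subst hU hV hS hW; linear_combination 4 * hd
    | right; subst hU hV hS hW; linear_combination (-4) * hd
  obtain ⟨d, hdd, det⟩ : ∃ d : ℤ, (d = 1 ∨ d = -1) ∧ U * W - V * S = 4 * d := by
    rcases det with h | h
    · exact ⟨e, he, h⟩
    · exact ⟨-e, by omega, h⟩
  have detr : (U : ℝ) * W - V * S = 4 * d := by exact_mod_cast det
  have dd : (d : ℝ) * d = 1 := by rcases hdd with rfl | rfl <;> norm_num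
  have Q1 : A * U ^ 2 + B * V ^ 2 = 4 * A' := by
    rw [hUr, hVr]; linear_combination q1 + q2 + 2 * q3
  have Q2 : A * S ^ 2 + B * W ^ 2 = 4 * B' := by
    rw [hSr, hWr]; linear_combination q1 + q2 - 2 * q3
  have Q3 : A * U * S + B * V * W = 0 := by
    rw [hUr, hVr, hSr, hWr]; linear_combination q1 - q2
  have E1 : A * U * d = A' * W := by
    linear_combination (W / 4) * Q1 - (V / 4) * Q3 - A * U / 4 * detr
  have E2 : B * V * d = - A' * S := by
    linear_combination (-S / 4) * Q1 + (U / 4) * Q3 - B * V / 4 * detr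
  have E3 : A * S * d = - B' * V := by
    linear_combination (-V / 4) * Q2 + (W / 4) * Q3 - A * S / 4 * detr
  have E4 : B * W * d = B' * U := by
    linear_combination (U / 4) * Q2 - (S / 4) * Q3 - B * W / 4 * detr
  have d0 : (d : ℝ) ≠ 0 := by intro h; simp [h] at dd
  have := aux_int d U V S W hdd det ?_ ?_ ?_ ?_ ?_ ?_ ?_
  · rcases this with ⟨h, h0⟩ | ⟨h, h0⟩
    · left
      have hr : (U : ℝ) = d * W := by exact_mod_cast h
      have hr0 : (U : ℝ) ≠ 0 := by exact_mod_cast h0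
      have hW' : (W : ℝ) = d * U := by rw [hr]; linear_combination (-(W : ℝ)) * dd
      have hz : (U : ℝ) * d ≠ 0 := mul_ne_zero hr0 d0
      constructor
      · apply mul_right_cancel₀ hz; rw [hW'] at E1; linear_combination E1
      · apply mul_right_cancel₀ hr0; rw [hW'] at E4; linear_combination E4 - B * U * dd
    · right
      have hr : (V : ℝ) = -d * S := by exact_mod_cast h
      have hr0 : (V : ℝ) ≠ 0 := by exact_mod_cast h0
      have hS' : (S : ℝ) = -d * V := by rw [hr]; linear_combination (-(S : ℝ)) * dd
      have hz : (V : ℝ) * d ≠ 0 := mul_ne_zero hr0 d0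
      constructor
      · apply mul_right_cancel₀ hr0; rw [hS'] at E3; linear_combination -E3 - A * V * dd
      · apply mul_right_cancel₀ hz; rw [hS'] at E2; linear_combination E2
  · have : (0 : ℝ) ≤ d * (U * W) := by
      have h : A' * (d * (U * W)) = A * U ^ 2 := by
        linear_combination (-d * U : ℝ) * E1 + A * U ^ 2 * dd
      have : 0 ≤ A' * (d * (U * W)) := by rw [h]; positivity
      exact nonneg_of_mul_nonneg_right this hA'
    exact_mod_cast this
  · have : (0 : ℝ) ≤ -d * (V * S) := by
      have h : A' * (-d * (V * S)) = B * V ^ 2 := by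
        linear_combination (-d * V : ℝ) * E2 + B * V ^ 2 * dd
      have : 0 ≤ A' * (-d * (V * S)) := by rw [h]; positivity
      exact nonneg_of_mul_nonneg_right this hA'
    exact_mod_cast this
  · constructor
    · rintro h; rw [h] at E1; simpa [hA'.ne'] using E1
    · rintro h; rw [h] at E1; simpa [hA.ne', d0] using E1
  · constructor
    · rintro h; rw [h] at E2; simpa [hA'.ne'] using E2
    · rintro h; rw [h] at E2; simpa [hB.ne', d0] using E2
  · exact ⟨m + r, by omega⟩
  · exact ⟨m + n, by omega⟩
  · exact ⟨m + s, by omega⟩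

/-- The case in which the distinguished vector lies in the plane. -/
lemma aux_two (A B l : ℝ) (hA : 0 < A) (hB : 0 < B) (hl : 0 < l) (m n i j : ℤ)
    (h1 : (A + B) * m + (A - B) * n = l * i) (h2 : (A - B) * m + (A + B) * n = l * j)
    (h3 : m * i + n * j = 1) : 2 * A = l ∧ 2 * B = l := by
  have hp : 2 * A * ((m + n : ℤ) : ℝ) = l * ((i + j : ℤ) : ℝ) := by
    push_cast; linear_combination h1 + h2
  have hq : 2 * B * ((m - n : ℤ) : ℝ) = l * ((i - j : ℤ) : ℝ) := by
    push_cast; linear_combination h1 - h2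
  have hs : (m + n) * (i + j) + (m - n) * (i - j) = 2 := by linear_combination 2 * h3
  have pu : Even ((m + n) + (m - n)) := ⟨m, by ring⟩
  have pp : Even ((i + j) + (i - j)) := ⟨i, by ring⟩
  generalize m + n = u at *
  generalize m - n = v at *
  generalize i + j = p at *
  generalize i - j = q at *
  have nn : ∀ (C : ℝ) (u p : ℤ), 0 < C → 2 * C * (u : ℝ) = l * p → 0 ≤ u * p := by
    intro C u p hC h
    have h' : l * ((u : ℝ) * p) = 2 * C * u ^ 2 := by linear_combination (-(u : ℝ)) * h
    have : 0 ≤ l * ((u : ℝ) * p) := by rw [h']; positivity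
    exact_mod_cast nonneg_of_mul_nonneg_right this hl
  have zz : ∀ (C : ℝ) (u p : ℤ), 0 < C → 2 * C * (u : ℝ) = l * p → u * p = 0 → u = 0 ∧ p = 0 := by
    intro C u p hC h h0
    rcases mul_eq_zero.1 h0 with h0 | h0
    · subst h0; simpa [hl.ne'] using h.symm
    · subst h0; simpa [hC.ne'] using h
  have oo : ∀ (C : ℝ) (u p : ℤ), 2 * C * (u : ℝ) = l * p → u * p = 1 → 2 * C = l := by
    intro C u p h h1
    rcases Int.mul_eq_one_iff_eq_one_or_neg_one.1 h1 with ⟨rfl, rfl⟩ | ⟨rfl, rfl⟩ <;>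
      push_cast at h <;> linarith
  have ev : ∀ u p : ℤ, Even u → Even p → u * p ≠ 2 := by
    rintro _ _ ⟨a, rfl⟩ ⟨b, rfl⟩ h
    have : 2 * (a * b) = 1 := by linarith
    omega
  have n1 := nn A u p hA hp
  have n2 := nn B v q hB hq
  rcases (by omega : u * p = 0 ∨ u * p = 1 ∨ v * q = 0) with h | h | h
  · obtain ⟨rfl, rfl⟩ := zz A u p hA hp h
    exact absurd (by linarith) (ev v q (by simpa using pu) (by simpa using pp))
  · exact ⟨oo A u p hp h, oo B v q hq (by linarith)⟩
  · obtain ⟨rfl, rfl⟩ := zz B v q hB hq h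
    exact absurd (by linarith) (ev u p (by simpa using pu) (by simpa using pp))

/-- Matrix version of `aux_two`. -/
lemma aux_mat (x y x' y' l : ℝ) (hx : 0 < x) (hy : 0 < y) (hl : 0 < l)
    (g h : Matrix (Fin 3) (Fin 3) ℤ) (hgh : g * h = 1) (h0 : h 1 1 = 0)
    (hm : GoC x y * (g.map (Int.cast : ℤ → ℝ))ᵀ =
      l • (h.map (Int.cast : ℤ → ℝ) * GoC x' y')) : x ^ 2 = 2 * l ∧ y ^ 2 = 2 * l := by
  have a1 := congrFun (congrFun hm 0) 1
  have a2 := congrFun (congrFun hm 2) 1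
  have a3 := congrFun (congrFun hgh 1) 1
  simp [GoC, Matrix.mul_apply, Fin.sum_univ_three, h0] at a1 a2 a3
  obtain ⟨r1, r2⟩ := aux_two (x ^ 2 / 4) (y ^ 2 / 4) l (by positivity) (by positivity) hl
    (g 1 0) (g 1 2) (h 0 1) (h 2 1) (by linear_combination a1) (by linear_combination a2) a3
  constructor <;> linarith

theorem stmt15 (x₁ y₁ x₂ y₂ : ℝ) (hx₁ : 0 < x₁) (hxy₁ : x₁ ≤ y₁)
    (hx₂ : 0 < x₂) (hxy₂ : x₂ ≤ y₂)
    (g : Matrix (Fin 3) (Fin 3) ℤ) (hg : g.det = 1 ∨ g.det = -1)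
    (lam : ℝ) (hlam : 0 < lam)
    (heq : g.map (Int.cast : ℤ → ℝ) * GoC x₁ y₁ * (g.map (Int.cast : ℤ → ℝ))ᵀ =
      lam • GoC x₂ y₂) :
    x₁ = x₂ ∧ y₁ = y₂ ∧ lam = 1 := by
  have hy₁ : 0 < y₁ := hx₁.trans_le hxy₁
  have hy₂ : 0 < y₂ := hx₂.trans_le hxy₂
  have hu : IsUnit g.det := by rcases hg with h | h <;> simp [h]
  obtain ⟨h, hgh, hhg⟩ : ∃ h, g * h = 1 ∧ h * g = 1 :=
    ⟨g⁻¹, Matrix.mul_nonsing_inv g hu, Matrix.nonsing_inv_mul g hu⟩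
  have castmul : ∀ a b : Matrix (Fin 3) (Fin 3) ℤ, a * b = 1 →
      a.map (Int.cast : ℤ → ℝ) * b.map (Int.cast : ℤ → ℝ) = 1 := by
    intro a b hab
    have := congrArg (fun M => (Int.castRingHom ℝ).mapMatrix M) hab
    simp only [map_mul, map_one] at this
    exact this
  have hGH := castmul _ _ hgh
  have hHG := castmul _ _ hhg
  have m1 : GoC x₁ y₁ * (g.map (Int.cast : ℤ → ℝ))ᵀ =
      lam • (h.map (Int.cast : ℤ → ℝ) * GoC x₂ y₂) := by
    rw [← Matrix.mul_smul, ← heq, ← Matrix.mul_assoc, ← Matrix.mul_assoc, hHG, Matrix.one_mul]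
  have hGHt : (g.map (Int.cast : ℤ → ℝ))ᵀ * (h.map (Int.cast : ℤ → ℝ))ᵀ = 1 := by
    rw [← Matrix.transpose_mul, hHG, Matrix.transpose_one]
  have m2 : GoC x₂ y₂ * (h.map (Int.cast : ℤ → ℝ))ᵀ =
      lam⁻¹ • (g.map (Int.cast : ℤ → ℝ) * GoC x₁ y₁) := by
    have : g.map (Int.cast : ℤ → ℝ) * GoC x₁ y₁ =
        lam • (GoC x₂ y₂ * (h.map (Int.cast : ℤ → ℝ))ᵀ) := by
      rw [← Matrix.smul_mul, ← heq, Matrix.mul_assoc _ _ (h.map _)ᵀ, hGHt, Matrix.mul_one]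
    rw [this, smul_smul, inv_mul_cancel₀ hlam.ne', one_smul]
  have c := congrFun (congrFun m1 1) 1
  simp [GoC, Matrix.mul_apply, Fin.sum_univ_three] at c
  have sqinj : ∀ a b : ℝ, 0 < a → 0 < b → a ^ 2 = b ^ 2 → a = b := fun a b ha hb hab =>
    (sq_eq_sq₀ ha.le hb.le).1 hab
  by_cases h0 : h 1 1 = 0
  · have g0 : g 1 1 = 0 := by
      rw [h0] at c; simpa using c
    obtain ⟨r1, r2⟩ := aux_mat x₁ y₁ x₂ y₂ lam hx₁ hy₁ hlam g h hgh h0 m1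
    obtain ⟨r3, r4⟩ := aux_mat x₂ y₂ x₁ y₁ lam⁻¹ hx₂ hy₂ (inv_pos.2 hlam) h g hhg g0 m2
    have hdet := congrArg Matrix.det heq
    have hdd : (g.map (Int.cast : ℤ → ℝ)).det ^ 2 = 1 := by
      have : (g.map (Int.cast : ℤ → ℝ)).det = (g.det : ℝ) := by
        exact ((Int.castRingHom ℝ).map_det g).symm
      rw [this]; rcases hg with h | h <;> simp [h]
    have dG : ∀ x y : ℝ, (GoC x y).det = x ^ 2 * y ^ 2 / 4 := by
      intro x y; simp [GoC, Matrix.det_fin_three]; ring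
    rw [Matrix.det_mul, Matrix.det_mul, Matrix.det_transpose, Matrix.det_smul, dG, dG, r1, r2, r3,
      r4] at hdet
    simp only [Fintype.card_fin] at hdet
    have e1 : lam ^ 3 * (2 * lam⁻¹ * (2 * lam⁻¹) / 4) = lam := by field_simp; norm_num
    have e2 : lam * lam = lam * 1 := by linear_combination hdet + e1 - lam ^ 2 * hdd
    have l1 : lam = 1 := mul_left_cancel₀ hlam.ne' e2
    subst l1
    refine ⟨sqinj _ _ hx₁ hx₂ ?_, sqinj _ _ hy₁ hy₂ ?_, rfl⟩
    · rw [r1, r3]; norm_num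
    · rw [r2, r4]; norm_num
  · have q := fun i j => congrFun (congrFun heq i) j
    have q11 := q 1 1
    have q01 := q 0 1
    have q21 := q 2 1
    have q00 := q 0 0
    have q22 := q 2 2
    have q02 := q 0 2
    simp [GoC, Matrix.mul_apply, Fin.sum_univ_three] at q11 q01 q21 q00 q22 q02
    have hx2 : 0 < x₁ ^ 2 := by positivity
    have hy2 : 0 < y₁ ^ 2 := by positivity
    have n11 : x₁ ^ 2 * ((g 1 0 : ℝ) + g 1 2) ^ 2 + y₁ ^ 2 * ((g 1 0 : ℝ) - g 1 2) ^ 2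
        + 4 * (g 1 1 : ℝ) ^ 2 = 4 * lam := by linear_combination 4 * q11
    have t1 : 0 ≤ x₁ ^ 2 * ((g 1 0 : ℝ) + g 1 2) ^ 2 := by positivity
    have t2 : 0 ≤ y₁ ^ 2 * ((g 1 0 : ℝ) - g 1 2) ^ 2 := by positivity
    have gle : (g 1 1 : ℝ) ^ 2 ≤ lam := by linarith
    have h0r : (h 1 1 : ℝ) ≠ 0 := by exact_mod_cast h0
    have pr : (g 1 1 : ℝ) * h 1 1 = lam * (h 1 1 : ℝ) ^ 2 := by rw [c]; ring
    have prpos : (0 : ℝ) < (g 1 1 : ℝ) * h 1 1 := by rw [pr]; positivity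
    have prle : (g 1 1 : ℝ) * h 1 1 ≤ 1 := by
      have : lam * ((g 1 1 : ℝ) * h 1 1) ≤ lam * 1 := by
        have : lam * ((g 1 1 : ℝ) * h 1 1) = (g 1 1 : ℝ) ^ 2 := by
          linear_combination (-(g 1 1 : ℝ)) * c
        linarith
      exact le_of_mul_le_mul_left this hlam
    have pri : g 1 1 * h 1 1 = 1 := by
      have a : 0 < g 1 1 * h 1 1 := by exact_mod_cast prpos
      have b : g 1 1 * h 1 1 ≤ 1 := by exact_mod_cast prle
      omega
    have l1 : lam = 1 ∧ (g 1 1 = 1 ∨ g 1 1 = -1) := by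
      rcases Int.mul_eq_one_iff_eq_one_or_neg_one.1 pri with ⟨a, b⟩ | ⟨a, b⟩ <;>
        rw [a, b] at c <;> push_cast at c <;> exact ⟨by linarith, by simp [a]⟩
    obtain ⟨l1, hg1⟩ := l1
    subst l1
    have gsq : (g 1 1 : ℝ) ^ 2 = 1 := by rcases hg1 with a | a <;> simp [a]
    have g0 : (g 1 1 : ℝ) ≠ 0 := by intro a; simp [a] at gsq
    have u0 : (g 1 0 : ℝ) + g 1 2 = 0 := by
      have : x₁ ^ 2 * ((g 1 0 : ℝ) + g 1 2) ^ 2 = 0 := by linarith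
      simpa [hx₁.ne'] using this
    have v0 : (g 1 0 : ℝ) - g 1 2 = 0 := by
      have : y₁ ^ 2 * ((g 1 0 : ℝ) - g 1 2) ^ 2 = 0 := by linarith
      simpa [hy₁.ne'] using this
    have g10 : (g 1 0 : ℝ) = 0 := by linarith
    have g12 : (g 1 2 : ℝ) = 0 := by linarith
    rw [g10, g12] at q01 q21
    have g01 : (g 0 1 : ℝ) = 0 := by simpa [g0] using q01
    have g21 : (g 2 1 : ℝ) = 0 := by simpa [g0] using q21
    rw [g01] at q00 q02
    rw [g21] at q22 q02
    norm_cast at g10 g12 g01 g21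
    rw [Matrix.det_fin_three, g10, g12, g01, g21] at hg
    obtain ⟨e, he, hd⟩ : ∃ e : ℤ, (e = 1 ∨ e = -1) ∧ g 0 0 * g 2 2 - g 0 2 * g 2 0 = e := by
      refine ⟨_, ?_, rfl⟩
      rcases hg1 with a | a <;> rw [a] at hg <;> rcases hg with hg | hg
      · left; linarith
      · right; linarith
      · right; linarith
      · left; linarith
    have := aux_plane (x₁ ^ 2) (y₁ ^ 2) (x₂ ^ 2) (y₂ ^ 2) (by positivity) (by positivity)
      (by positivity) (by positivity) (g 0 0) (g 0 2) (g 2 0) (g 2 2) e he hd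
      (by linear_combination 4 * q00) (by linear_combination 4 * q22)
      (by linear_combination 4 * q02)
    rcases this with ⟨a, b⟩ | ⟨a, b⟩
    · exact ⟨sqinj _ _ hx₁ hx₂ a, sqinj _ _ hy₁ hy₂ b, rfl⟩
    · have a' := sqinj _ _ hx₁ hy₂ a
      have b' := sqinj _ _ hy₁ hx₂ b
      exact ⟨by linarith, by linarith, rfl⟩
end
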